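/- arXiv:1610.04838 — 2 statements merged into one kernel-verified Lean document; each statement's English description precedes it below -/
import Mathlib

section
/- Let G=(V,E) be a finite simple undirected graph on n vertices with minimum degree at least n/2 (a Dirac graph), and let t be the threshold function with t(v)=2 for every v ∈ V. Then there exists a target set for (G,t) of cardinality at most 2. -/
open scoped Classical

noncomputable section

variable {V : Type*}

/-- The in-neighborhood of `u` in the digraph with arc relation `E`.
For an undirected graph `G` we use `E = G.Adj`, so this is the ordinary neighborhood. -/
def inNbrs [Fintype V] (E : V → V → Prop) (u : V) : Finset V :=
  Finset.univ.filter fun w => E w u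

/-- The activation process: `activeProcess E t S ℓ = Active[S, ℓ]`. -/
def activeProcess [Fintype V] (E : V → V → Prop) (t : V → ℕ) (S : Finset V) : ℕ → Finset V
  | 0 => S
  | ℓ + 1 =>
      activeProcess E t S ℓ ∪
        Finset.univ.filter fun u => t u ≤ (inNbrs E u ∩ activeProcess E t S ℓ).card

/-- `S` is a target set for the digraph with arc relation `E` and thresholds `t`. -/
def IsTargetSet [Fintype V] (E : V → V → Prop) (t : V → ℕ) (S : Finset V) : Prop :=
  ∃ ℓ : ℕ, activeProcess E t S ℓ = Finset.univ

theorem activeProcess_subset_succ [Fintype V] (E : V → V → Prop) (t : V → ℕ) (S : Finset V)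
    (ℓ : ℕ) : activeProcess E t S ℓ ⊆ activeProcess E t S (ℓ + 1) :=
  Finset.subset_union_left

theorem activeProcess_monotone [Fintype V] (E : V → V → Prop) (t : V → ℕ) (S : Finset V) :
    Monotone (activeProcess E t S) :=
  monotone_nat_of_le_succ (activeProcess_subset_succ E t S)

/-- If every closed superset of `S` is everything, then `S` is a target set. -/
theorem isTargetSet_of_forall_closed [Fintype V] {E : V → V → Prop} {t : V → ℕ} {S : Finset V}
    (h : ∀ C : Finset V, S ⊆ C → (∀ u ∉ C, (inNbrs E u ∩ C).card < t u) → C = Finset.univ) :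
    IsTargetSet E t S := by
  obtain ⟨ℓ, hℓ⟩ := WellFoundedGT.monotone_chain_condition
    (⟨activeProcess E t S, activeProcess_monotone E t S⟩ : ℕ →o Finset V)
  refine ⟨ℓ, h _ (activeProcess_monotone E t S (Nat.zero_le ℓ)) fun u hu => ?_⟩
  by_contra! hcard
  have hstable : activeProcess E t S ℓ = activeProcess E t S (ℓ + 1) := hℓ (ℓ + 1) ℓ.le_succ
  refine hu (hstable ▸ ?_)
  exact Finset.mem_union_right _ (Finset.mem_filter.mpr ⟨Finset.mem_univ u, hcard⟩)

theorem inNbrs_adj [Fintype V] (G : SimpleGraph V) (u : V) :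
    inNbrs G.Adj u = G.neighborFinset u := by
  ext w
  simp [inNbrs, G.adj_comm]

theorem card_neighborFinset_inter_add_compl [Fintype V] (G : SimpleGraph V) (C : Finset V)
    (u : V) :
    (G.neighborFinset u ∩ C).card + (G.neighborFinset u ∩ Cᶜ).card = G.degree u := by
  rw [← Finset.sdiff_eq_inter_compl, Finset.card_inter_add_card_sdiff,
    G.card_neighborFinset_eq_degree]

theorem card_neighborFinset_inter_lt [Fintype V] (G : SimpleGraph V) {C : Finset V}
    {u : V} (hu : u ∈ C) : (G.neighborFinset u ∩ C).card < C.card :=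
  Finset.card_lt_card <| Finset.ssubset_iff_of_subset Finset.inter_subset_right |>.mpr
    ⟨u, hu, by simp⟩

theorem card_neighborFinset_inter_add_two_le [Fintype V] (G : SimpleGraph V) {C : Finset V}
    {a c : V} (ha : a ∈ C) (hc : c ∈ C) (hne : a ≠ c) (hadj : ¬G.Adj a c) :
    (G.neighborFinset a ∩ C).card + 2 ≤ C.card := by
  rw [← Finset.card_pair hne, ← Finset.card_union_of_disjoint (by simp [hadj])]
  refine Finset.card_le_card (Finset.union_subset Finset.inter_subset_right ?_)
  simp [Finset.insert_subset_iff, ha, hc]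

theorem sum_card_neighborFinset_inter_comm [Fintype V] (G : SimpleGraph V) (A B : Finset V) :
    ∑ u ∈ A, (G.neighborFinset u ∩ B).card = ∑ v ∈ B, (G.neighborFinset v ∩ A).card := by
  have key := Finset.sum_card_bipartiteAbove_eq_sum_card_bipartiteBelow (s := A) (t := B) G.Adj
  convert key using 3 with u _ v _
  · ext w; simp [Finset.mem_bipartiteAbove, and_comm]
  · ext w; simp [Finset.mem_bipartiteBelow, and_comm, G.adj_comm]

/-- In a Dirac graph, a set that is closed for thresholds 2 and contains two distinct nonadjacent
vertices is everything. -/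
theorem eq_univ_of_closed_of_not_adj [Fintype V] (G : SimpleGraph V)
    (hDirac : ∀ v : V, Fintype.card V ≤ 2 * G.degree v) {C : Finset V}
    (hC : ∀ u ∉ C, (G.neighborFinset u ∩ C).card < 2)
    {a c : V} (ha : a ∈ C) (hc : c ∈ C) (hne : a ≠ c) (hadj : ¬G.Adj a c) :
    C = Finset.univ := by
  by_contra hproper
  obtain ⟨v, hv⟩ : ∃ v, v ∉ C := by
    simpa [Finset.eq_univ_iff_forall] using hproper
  have hcompl : C.card + Cᶜ.card = Fintype.card V := Finset.card_add_card_compl C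
  have hsmall : 2 * C.card ≤ Fintype.card V := by
    have hsplit := card_neighborFinset_inter_add_compl G C v
    have hout := card_neighborFinset_inter_lt G (Finset.mem_compl.mpr hv)
    have hin := hC v hv
    have hdeg := hDirac v
    omega
  have htwo := card_neighborFinset_inter_add_two_le G ha hc hne hadj
  have hupper : ∑ u ∈ C, (G.neighborFinset u ∩ Cᶜ).card ≤ Cᶜ.card := by
    rw [sum_card_neighborFinset_inter_comm, Finset.card_eq_sum_ones]
    exact Finset.sum_le_sum fun u hu => Nat.le_of_lt_succ (hC u (Finset.mem_compl.mp hu))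
  have hlower : ∑ _u ∈ C, (Fintype.card V + 2) <
      ∑ u ∈ C, (2 * (G.neighborFinset u ∩ Cᶜ).card + 2 * C.card) := by
    refine Finset.sum_lt_sum (fun u hu => ?_) ⟨a, ha, ?_⟩
    · have hsplit := card_neighborFinset_inter_add_compl G C u
      have hin := card_neighborFinset_inter_lt G hu
      have hdeg := hDirac u
      omega
    · have hsplit := card_neighborFinset_inter_add_compl G C a
      have hdeg := hDirac a
      omega
  simp only [Finset.sum_add_distrib, ← Finset.mul_sum, Finset.sum_const, smul_eq_mul] at hlower
  have hcard : 2 ≤ C.card := by omega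
  zify at hlower hupper hcompl hcard hsmall
  nlinarith [mul_nonneg (sub_nonneg.mpr hcard) (sub_nonneg.mpr hsmall)]

/-- Every Dirac graph (minimum degree at least half the number of vertices) with all
thresholds equal to 2 has a target set of size at most 2. -/
theorem dirac_target_set_card_le_two [Fintype V] (G : SimpleGraph V)
    (hDirac : ∀ v : V, Fintype.card V ≤ 2 * G.degree v) :
    ∃ S : Finset V, IsTargetSet G.Adj (fun _ => 2) S ∧ S.card ≤ 2 := by
  by_cases hcomplete : ∀ a c : V, a ≠ c → G.Adj a c
  · rcases le_or_gt (Fintype.card V) 2 with hn | hn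
    · exact ⟨Finset.univ, ⟨0, rfl⟩, hn⟩
    · obtain ⟨S, -, hS⟩ := Finset.exists_subset_card_eq (s := (Finset.univ : Finset V)) hn.le
      refine ⟨S, isTargetSet_of_forall_closed fun C hSC hC => ?_, hS.le⟩
      by_contra hproper
      obtain ⟨v, hv⟩ : ∃ v, v ∉ C := by
        simpa [Finset.eq_univ_iff_forall] using hproper
      refine (hC v hv).not_ge (hS ▸ Finset.card_le_card fun u hu => ?_)
      have hne : u ≠ v := fun h => hv (h ▸ hSC hu)
      simp [inNbrs, hSC hu, hcomplete u v hne]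
  · push Not at hcomplete
    obtain ⟨a, c, hne, hadj⟩ := hcomplete
    refine ⟨{a, c}, isTargetSet_of_forall_closed fun C hSC hC => ?_, Finset.card_le_two⟩
    simp only [inNbrs_adj] at hC
    exact eq_univ_of_closed_of_not_adj G hDirac hC (hSC (by simp)) (hSC (by simp)) hne hadj
end
end

section
/- Let G=(V,E) be a finite directed graph with threshold function t : V → ℕ, let v ∈ V, and let S ⊆ V \ {v}. Let G' be the subdigraph of G induced by V \ {v}, with threshold function t' defined by t'(u) = max(t(u) − 1, 0) if u is an out-neighbor of v in G, and t'(u) = t(u) otherwise. Then for every ℓ ≥ 0, Active_G[S ∪ {v}, ℓ] \ {v} = Active_{G'}[S, ℓ]. In particular, S ∪ {v} is a target set for (G,t) if and only if S is a target set for (G',t'). -/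
open scoped Classical

noncomputable section

variable {V : Type*}

/-- Seeds stay active throughout the activation process. -/
theorem subset_activeProcess [Fintype V] (E : V → V → Prop) (t : V → ℕ) (S : Finset V) (ℓ : ℕ) :
    S ⊆ activeProcess E t S ℓ := by
  induction ℓ with
  | zero => exact Finset.Subset.refl S
  | succ ℓ ih => exact ih.trans Finset.subset_union_left

/-- An active vertex `v` contributes exactly one active in-neighbor to each of its
out-neighbors, and none to the other vertices. -/
theorem card_inNbrs_inter_of_erase_eq_map [Fintype V] (E : V → V → Prop) {v : V}
    [inst : DecidableEq {u : V // u ≠ v}] {A : Finset V} {B : Finset {u : V // u ≠ v}} (hv : v ∈ A)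
    (hAB : A.erase v = B.map (Function.Embedding.subtype _)) (u : {u : V // u ≠ v}) :
    (inNbrs E u ∩ A).card =
      (inNbrs (fun a b : {u : V // u ≠ v} => E a b) u ∩ B).card + if E v u then 1 else 0 := by
  have hmem : ∀ w : {u : V // u ≠ v}, (w : V) ∈ A ↔ w ∈ B := fun w => by
    have := congrArg ((w : V) ∈ ·) hAB
    simpa [w.2] using this
  have herase : (inNbrs E u ∩ A).erase v =
      (inNbrs (fun a b : {u : V // u ≠ v} => E a b) u ∩ B).map
        (Function.Embedding.subtype _) := by
    ext w
    by_cases hw : w = v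
    · simp [hw]
    · have := hmem ⟨w, hw⟩
      simp_all [inNbrs]
  rw [← Finset.card_map (Function.Embedding.subtype _), ← herase]
  split_ifs with h
  · exact (Finset.card_erase_add_one (by simp [inNbrs, h, hv])).symm
  · rw [Finset.erase_eq_of_notMem (by simp [inNbrs, h]), add_zero]

/-- Removing a seed vertex `v` and lowering the thresholds of its out-neighbors by one
yields the same activation process on the remaining vertices:
`Active_G[S ∪ {v}, ℓ] \ {v} = Active_{G'}[S, ℓ]` for every `ℓ`, where `G'` is the
subdigraph induced by `V \ {v}` and `t'(u) = max(t(u) − 1, 0)` for out-neighbors `u`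
of `v`, `t'(u) = t(u)` otherwise.  In particular `S ∪ {v}` is a target set for
`(G, t)` iff `S` is a target set for `(G', t')`. -/
theorem active_erase_seed [Fintype V] (E : V → V → Prop) (t : V → ℕ)
    (v : V) (S : Finset V) (hvS : v ∉ S) :
    (∀ ℓ : ℕ,
        (activeProcess E t (insert v S) ℓ).erase v =
          (activeProcess (fun a b : {u : V // u ≠ v} => E a b)
              (fun u : {u : V // u ≠ v} => if E v u then t u - 1 else t u)
              (S.subtype (· ≠ v)) ℓ).map (Function.Embedding.subtype _)) ∧
    (IsTargetSet E t (insert v S) ↔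
      IsTargetSet (fun a b : {u : V // u ≠ v} => E a b)
        (fun u : {u : V // u ≠ v} => if E v u then t u - 1 else t u)
        (S.subtype (· ≠ v))) := by
  have hv : ∀ ℓ, v ∈ activeProcess E t (insert v S) ℓ := fun ℓ =>
    subset_activeProcess E t _ ℓ (Finset.mem_insert_self v S)
  have key : ∀ ℓ : ℕ,
      (activeProcess E t (insert v S) ℓ).erase v =
        (activeProcess (fun a b : {u : V // u ≠ v} => E a b)
            (fun u : {u : V // u ≠ v} => if E v u then t u - 1 else t u)
            (S.subtype (· ≠ v)) ℓ).map (Function.Embedding.subtype _) := by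
    intro ℓ
    induction ℓ with
    | zero =>
      ext w
      by_cases hw : w = v
      · simp [hw]
      · simp [activeProcess, hw]
    | succ ℓ ih =>
      ext w
      by_cases hw : w = v
      · simp [hw]
      · have hmap (B : Finset {u : V // u ≠ v}) :
            w ∈ B.map (Function.Embedding.subtype _) ↔ ⟨w, hw⟩ ∈ B :=
          Finset.mem_map' (Function.Embedding.subtype _) (a := ⟨w, hw⟩)
        have hmem := Finset.ext_iff.1 ih w
        have hcard := card_inNbrs_inter_of_erase_eq_map E
          (inst := fun a b => Classical.propDecidable (a = b)) (hv ℓ) ih ⟨w, hw⟩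
        rw [hmap, Finset.mem_erase, and_iff_right hw] at hmem
        rw [hmap, Finset.mem_erase, and_iff_right hw]
        simp only [activeProcess, Finset.mem_union, Finset.mem_filter, Finset.mem_univ, true_and]
        refine or_congr hmem ?_
        dsimp only at hcard ⊢
        rw [hcard]
        split_ifs <;> omega
  refine ⟨key, exists_congr fun ℓ => ?_⟩
  have hℓ := key ℓ
  simp only [Finset.eq_univ_iff_forall]
  constructor
  · intro h u
    have hu : (u : V) ∈ (activeProcess E t (insert v S) ℓ).erase v :=
      Finset.mem_erase.2 ⟨u.2, h u⟩
    rw [hℓ] at hu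
    exact (Finset.mem_map' (Function.Embedding.subtype _)).1 hu
  · intro h w
    by_cases hw : w = v
    · exact hw ▸ hv ℓ
    · refine Finset.erase_subset v _ ?_
      rw [hℓ]
      exact Finset.mem_map_of_mem (Function.Embedding.subtype _) (h ⟨w, hw⟩)
end
end
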